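/- Let A ⊆ {-1,1}^n be nonempty with density α = |A|/2^n, and let f = 1_A be the characteristic function of A. Then the sum over i ∈ {1,...,n} of the squares of the level-1 Fourier coefficients satisfies Σ_{i=1}^n f̂({i})² ≤ 2 α² ln(1/α). -/

import Mathlib

/-- The moment generating function of a linear form in Rademacher variables is sub-Gaussian. -/
theorem sum_exp_sum_mul_sign_le {ι : Type*} [Fintype ι] [DecidableEq ι] (a : ι → ℝ) :
    ∑ x : ι → Bool, Real.exp (∑ i, a i * (if x i then (1 : ℝ) else -1))
      ≤ 2 ^ Fintype.card ι * Real.exp ((∑ i, a i ^ 2) / 2) := by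
  calc ∑ x : ι → Bool, Real.exp (∑ i, a i * (if x i then (1 : ℝ) else -1))
      = ∏ i, ∑ b : Bool, Real.exp (a i * (if b then (1 : ℝ) else -1)) := by
        simp only [Real.exp_sum, Fintype.prod_sum]
    _ = ∏ i, 2 * Real.cosh (a i) := by
        refine Finset.prod_congr rfl fun i _ => ?_
        simp [Real.cosh_eq]
        ring
    _ ≤ ∏ i, 2 * Real.exp (a i ^ 2 / 2) := by
        gcongr with i
        exact Real.cosh_le_exp_half_sq (a i)
    _ = 2 ^ Fintype.card ι * Real.exp ((∑ i, a i ^ 2) / 2) := by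
        simp [Finset.prod_mul_distrib, Finset.sum_div, Real.exp_sum]

/-- Jensen's inequality for the exponential over the uniform measure on a nonempty finite set. -/
theorem card_mul_exp_average_le {β : Type*} {A : Finset β} (hA : A.Nonempty) (g : β → ℝ) :
    A.card * Real.exp ((A.card : ℝ)⁻¹ * ∑ x ∈ A, g x) ≤ ∑ x ∈ A, Real.exp (g x) := by
  have hc : (0 : ℝ) < A.card := by exact_mod_cast hA.card_pos
  have h := convexOn_exp.map_sum_le (t := A) (w := fun _ => (A.card : ℝ)⁻¹) (p := g)
    (fun _ _ => by positivity) (by simp [hc.ne']) (fun _ _ => Set.mem_univ _)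
  simp only [smul_eq_mul, ← Finset.mul_sum] at h
  rwa [inv_mul_eq_div, inv_mul_eq_div, le_div_iff₀' hc, ← inv_mul_eq_div] at h

/-- The squared norm of the barycentre of a subset of the cube is at most twice the logarithm
of its inverse density. -/
theorem sum_sq_average_sign_le {ι : Type*} [Fintype ι] [DecidableEq ι]
    {A : Finset (ι → Bool)} (hA : A.Nonempty) :
    ∑ i, ((A.card : ℝ)⁻¹ * ∑ x ∈ A, (if x i then (1 : ℝ) else -1)) ^ 2
      ≤ 2 * Real.log (2 ^ Fintype.card ι / A.card) := by
  have hc : (0 : ℝ) < A.card := by exact_mod_cast hA.card_pos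
  set m : ι → ℝ := fun i => (A.card : ℝ)⁻¹ * ∑ x ∈ A, (if x i then (1 : ℝ) else -1)
  have havg : (A.card : ℝ)⁻¹ * ∑ x ∈ A, ∑ i, m i * (if x i then (1 : ℝ) else -1)
      = ∑ i, m i ^ 2 := by
    rw [Finset.sum_comm, Finset.mul_sum]
    refine Finset.sum_congr rfl fun i _ => ?_
    rw [← Finset.mul_sum, mul_left_comm, sq]
  have hexp : A.card * Real.exp (∑ i, m i ^ 2)
      ≤ 2 ^ Fintype.card ι * Real.exp ((∑ i, m i ^ 2) / 2) := by
    rw [← havg]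
    refine (card_mul_exp_average_le hA _).trans ?_
    rw [havg]
    exact (Finset.sum_le_univ_sum_of_nonneg fun _ => (Real.exp_pos _).le).trans
      (sum_exp_sum_mul_sign_le m)
  have hhalf : (∑ i, m i ^ 2) / 2 ≤ Real.log (2 ^ Fintype.card ι / A.card) := by
    rw [Real.le_log_iff_exp_le (by positivity), le_div_iff₀' hc]
    refine le_of_mul_le_mul_right ?_ (Real.exp_pos ((∑ i, m i ^ 2) / 2))
    rwa [mul_assoc, ← Real.exp_add, add_halves]
  change ∑ i, m i ^ 2 ≤ _
  linarith

/-- **Chang's lemma** (level-1 inequality) on the Boolean cube.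
We model `{-1,1}^n` as `Fin n → Bool`, a point `x` corresponding to the
real vector with `i`-th coordinate `1` if `x i = true` and `-1` otherwise.
For the characteristic function `f = 1_A`, the Fourier coefficient is
`f̂({i}) = 2⁻ⁿ * ∑_{x ∈ A} x_i`, and we prove
`∑ i, f̂({i})² ≤ 2 α² ln(1/α)` where `α = |A| / 2ⁿ`. -/
theorem chang_lemma (n : ℕ) (A : Finset (Fin n → Bool)) (hA : A.Nonempty)
    (α : ℝ) (hα : α = (A.card : ℝ) / 2 ^ n) :
    ∑ i : Fin n,
      ((2 ^ n : ℝ)⁻¹ * ∑ x ∈ A, (if x i then (1 : ℝ) else -1)) ^ 2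
      ≤ 2 * α ^ 2 * Real.log (1 / α) := by
  have hc : (0 : ℝ) < A.card := by exact_mod_cast hA.card_pos
  have hsum : ∑ i : Fin n, ((2 ^ n : ℝ)⁻¹ * ∑ x ∈ A, (if x i then (1 : ℝ) else -1)) ^ 2
      = α ^ 2 * ∑ i, ((A.card : ℝ)⁻¹ * ∑ x ∈ A, (if x i then (1 : ℝ) else -1)) ^ 2 := by
    rw [Finset.mul_sum]
    refine Finset.sum_congr rfl fun i _ => ?_
    rw [hα]
    field_simp
  have h := mul_le_mul_of_nonneg_left (sum_sq_average_sign_le hA) (sq_nonneg α)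
  rw [Fintype.card_fin] at h
  rw [hsum, show 1 / α = 2 ^ n / A.card by rw [hα, one_div_div]]
  linarith
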